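/- Let Φ be a positive trace-preserving linear map from d×d to d'×d' complex matrices, Q a real-linear functional on Hermitian d×d matrices, and Σ(ρ) = S(Φ(ρ)) − S(ρ) + Q(ρ). Let 𝒮 be a convex set of density matrices, let φ ∈ 𝒮 satisfy Σ(φ) ≤ Σ(ω) for all ω ∈ 𝒮, and let ρ ∈ 𝒮 satisfy supp ρ ⊆ supp φ. Then Σ(ρ) − Σ(φ) ≥ S(ρ‖φ) − S(Φ(ρ)‖Φ(φ)). -/

import Mathlib

open Matrix
open scoped ComplexOrder

/-- Spectral logarithm of a Hermitian matrix (eigenvalue 0 ↦ 0 via `Real.log 0 = 0`). -/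
noncomputable def matLog {d : ℕ} (A : Matrix (Fin d) (Fin d) ℂ) : Matrix (Fin d) (Fin d) ℂ :=
  if hA : A.IsHermitian then
    (hA.eigenvectorUnitary : Matrix (Fin d) (Fin d) ℂ) *
      Matrix.diagonal (fun i => (Real.log (hA.eigenvalues i) : ℂ)) *
      (star (hA.eigenvectorUnitary : Matrix (Fin d) (Fin d) ℂ))
  else 0

/-- Von Neumann entropy `S(ρ) = -tr(ρ log ρ)`. -/
noncomputable def vN {d : ℕ} (ρ : Matrix (Fin d) (Fin d) ℂ) : ℝ :=
  -(ρ * matLog ρ).trace.re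

/-- Quantum relative entropy `S(ρ‖φ) = tr(ρ (log ρ - log φ))`. -/
noncomputable def qRelEnt {d : ℕ} (ρ φ : Matrix (Fin d) (Fin d) ℂ) : ℝ :=
  ((ρ * (matLog ρ - matLog φ)).trace).re

/-- A density matrix: positive semidefinite with unit trace. -/
def IsDensity {d : ℕ} (ρ : Matrix (Fin d) (Fin d) ℂ) : Prop :=
  ρ.PosSemidef ∧ ρ.trace = 1

/-- Support (= range) inclusion of matrices. -/
def SuppLE {d : ℕ} (ρ φ : Matrix (Fin d) (Fin d) ℂ) : Prop :=
  LinearMap.range ρ.mulVecLin ≤ LinearMap.range φ.mulVecLin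

/-- A positive trace-preserving linear map. -/
def IsPTP {d d' : ℕ} (Φ : Matrix (Fin d) (Fin d) ℂ →ₗ[ℂ] Matrix (Fin d') (Fin d') ℂ) : Prop :=
  (∀ X, X.PosSemidef → (Φ X).PosSemidef) ∧ (∀ X, (Φ X).trace = X.trace)

/-- The EP-type function `Σ(ρ) = S(Φ(ρ)) - S(ρ) + Q(ρ)`. -/
noncomputable def EPfun {d d' : ℕ} (Φ : Matrix (Fin d) (Fin d) ℂ →ₗ[ℂ] Matrix (Fin d') (Fin d') ℂ)
    (Q : Matrix (Fin d) (Fin d) ℂ →ₗ[ℝ] ℝ) (ρ : Matrix (Fin d) (Fin d) ℂ) : ℝ :=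
  vN (Φ ρ) - vN ρ + Q ρ

noncomputable def wgt {d : ℕ} (U V : Matrix (Fin d) (Fin d) ℂ) (i j : Fin d) : ℝ :=
  Complex.normSq ((star U * V) i j)

theorem wgt_nonneg {d : ℕ} (U V : Matrix (Fin d) (Fin d) ℂ) (i j : Fin d) : 0 ≤ wgt U V i j :=
  Complex.normSq_nonneg _

theorem specData {d : ℕ} {A : Matrix (Fin d) (Fin d) ℂ} (hA : A.PosSemidef) :
    ∃ (U : Matrix (Fin d) (Fin d) ℂ) (a : Fin d → ℝ), star U * U = 1 ∧ U * star U = 1 ∧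
      (∀ i, 0 ≤ a i) ∧ A = U * diagonal (fun i => (a i : ℂ)) * star U ∧
      matLog A = U * diagonal (fun i => (Real.log (a i) : ℂ)) * star U := by
  refine ⟨hA.1.eigenvectorUnitary, hA.1.eigenvalues, ?_, ?_, hA.eigenvalues_nonneg, ?_, ?_⟩
  · exact Unitary.coe_star_mul_self _
  · exact Unitary.coe_mul_star_self _
  · have := hA.1.spectral_theorem
    rw [Unitary.conjStarAlgAut_apply] at this
    exact this
  · rw [matLog, dif_pos hA.1]

theorem trW {d : ℕ} (U V : Matrix (Fin d) (Fin d) ℂ) (f g : Fin d → ℝ) :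
    ((U * diagonal (fun i => (f i : ℂ)) * star U) *
      (V * diagonal (fun i => (g i : ℂ)) * star V)).trace.re
      = ∑ i, ∑ j, wgt U V i j * (f i * g j) := by
  have h1 : ((U * diagonal (fun i => (f i : ℂ)) * star U) *
      (V * diagonal (fun i => (g i : ℂ)) * star V)).trace =
      (diagonal (fun i => (f i : ℂ)) * (star U * V) * (diagonal (fun i => (g i : ℂ)) *
        star (star U * V))).trace := by
    rw [star_mul, star_star]
    simp only [Matrix.mul_assoc]
    rw [Matrix.trace_mul_comm U]
    simp only [Matrix.mul_assoc]
  rw [h1, Matrix.trace]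
  simp only [Matrix.diag_apply, Matrix.mul_apply (M := diagonal _ * _), Matrix.diagonal_mul,
    Complex.re_sum, Matrix.star_apply]
  refine Finset.sum_congr rfl fun i _ => Finset.sum_congr rfl fun j _ => ?_
  simp only [wgt, Complex.normSq_apply]
  simp
  ring

theorem formulas {d : ℕ} {A B : Matrix (Fin d) (Fin d) ℂ} {U V : Matrix (Fin d) (Fin d) ℂ}
    {a b : Fin d → ℝ}
    (hU : star U * U = 1) (hU' : U * star U = 1) (hV : star V * V = 1) (hV' : V * star V = 1)
    (hA : A = U * diagonal (fun i => (a i : ℂ)) * star U)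
    (hlA : matLog A = U * diagonal (fun i => (Real.log (a i) : ℂ)) * star U)
    (hB : B = V * diagonal (fun i => (b i : ℂ)) * star V)
    (hlB : matLog B = V * diagonal (fun i => (Real.log (b i) : ℂ)) * star V)
    (htr : A.trace = B.trace) :
    qRelEnt A B = ∑ i, ∑ j, wgt U V i j *
      (a i * Real.log (a i) - a i * Real.log (b j) - a i + b j) ∧
    ((A - B) * (A - B)).trace.re = ∑ i, ∑ j, wgt U V i j * (a i - b j) ^ 2 := by
  have oneV : V * diagonal (fun i => (((fun _ => 1 : Fin d → ℝ) i : ℝ) : ℂ)) * star V = 1 := by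
    simp [hV']
  have oneU : U * diagonal (fun i => (((fun _ => 1 : Fin d → ℝ) i : ℝ) : ℂ)) * star U = 1 := by
    simp [hU']
  have mulU : ∀ f g : Fin d → ℝ, (U * diagonal (fun i => (f i : ℂ)) * star U) *
      (U * diagonal (fun i => (g i : ℂ)) * star U) =
      U * diagonal (fun i => (((fun i => f i * g i) i : ℝ) : ℂ)) * star U := by
    intro f g
    calc _ = U * diagonal (fun i => (f i : ℂ)) * (star U * U) * diagonal (fun i => (g i : ℂ)) * star U := by
          simp only [Matrix.mul_assoc]
      _ = _ := by
          rw [hU, Matrix.mul_one, Matrix.mul_assoc U, Matrix.diagonal_mul_diagonal]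
          simp
  have mulV : ∀ f g : Fin d → ℝ, (V * diagonal (fun i => (f i : ℂ)) * star V) *
      (V * diagonal (fun i => (g i : ℂ)) * star V) =
      V * diagonal (fun i => (((fun i => f i * g i) i : ℝ) : ℂ)) * star V := by
    intro f g
    calc _ = V * diagonal (fun i => (f i : ℂ)) * (star V * V) * diagonal (fun i => (g i : ℂ)) * star V := by
          simp only [Matrix.mul_assoc]
      _ = _ := by
          rw [hV, Matrix.mul_one, Matrix.mul_assoc V, Matrix.diagonal_mul_diagonal]
          simp
  have tU : ∀ f : Fin d → ℝ, (U * diagonal (fun i => (f i : ℂ)) * star U).trace.re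
      = ∑ i, ∑ j, wgt U V i j * (f i * 1) := by
    intro f
    have := trW U V f (fun _ => 1)
    rwa [oneV, Matrix.mul_one] at this
  have tV : ∀ f : Fin d → ℝ, (V * diagonal (fun i => (f i : ℂ)) * star V).trace.re
      = ∑ i, ∑ j, wgt U V i j * (1 * f j) := by
    intro f
    have := trW U V (fun _ => 1) f
    rwa [oneU, Matrix.one_mul] at this
  have htr' : A.trace.re = B.trace.re := by rw [htr]
  have eA : A.trace.re = ∑ i, ∑ j, wgt U V i j * (a i * 1) := by rw [hA]; exact tU a
  have eB : B.trace.re = ∑ i, ∑ j, wgt U V i j * (1 * b j) := by rw [hB]; exact tV b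
  have eAA : (A * A).trace.re = ∑ i, ∑ j, wgt U V i j * ((a i * a i) * 1) := by rw [hA, mulU]; exact tU _
  have eBB : (B * B).trace.re = ∑ i, ∑ j, wgt U V i j * (1 * (b j * b j)) := by rw [hB, mulV]; exact tV _
  have eAB : (A * B).trace.re = ∑ i, ∑ j, wgt U V i j * (a i * b j) := by rw [hA, hB]; exact trW _ _ _ _
  have eAlA : (A * matLog A).trace.re = ∑ i, ∑ j, wgt U V i j * ((a i * Real.log (a i)) * 1) := by rw [hlA, hA, mulU]; exact tU _
  have eAlB : (A * matLog B).trace.re = ∑ i, ∑ j, wgt U V i j * (a i * Real.log (b j)) := by rw [hlB, hA]; exact trW _ _ _ _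
  constructor
  · have : qRelEnt A B = (A * matLog A).trace.re - (A * matLog B).trace.re - A.trace.re + B.trace.re := by
      rw [htr', qRelEnt, Matrix.mul_sub, Matrix.trace_sub, Complex.sub_re]; ring
    rw [this, eAlA, eAlB, eA, eB]
    simp only [← Finset.sum_sub_distrib, ← Finset.sum_add_distrib]
    refine Finset.sum_congr rfl fun i _ => Finset.sum_congr rfl fun j _ => ?_
    ring
  · have : ((A - B) * (A - B)).trace.re = (A * A).trace.re - (A * B).trace.re - (A * B).trace.re + (B * B).trace.re := by
      rw [Matrix.mul_sub, Matrix.sub_mul, Matrix.sub_mul, Matrix.trace_sub, Matrix.trace_sub,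
        Matrix.trace_sub, Matrix.trace_mul_comm B A]
      simp only [Complex.sub_re]; ring
    rw [this, eAA, eAB, eBB]
    simp only [← Finset.sum_sub_distrib, ← Finset.sum_add_distrib]
    refine Finset.sum_congr rfl fun i _ => Finset.sum_congr rfl fun j _ => ?_
    ring

theorem ker_cond {d : ℕ} {A B : Matrix (Fin d) (Fin d) ℂ} {U V : Matrix (Fin d) (Fin d) ℂ}
    {a b : Fin d → ℝ} (hV : star V * V = 1)
    (ha : ∀ i, 0 ≤ a i)
    (hA : A = U * diagonal (fun i => (a i : ℂ)) * star U)
    (hB : B = V * diagonal (fun i => (b i : ℂ)) * star V) (c : ℝ)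
    (hc : ((c : ℂ) • B - A).PosSemidef) (i j : Fin d) (hj : b j = 0) :
    wgt U V i j * a i = 0 := by
  have h1 := hc.conjTranspose_mul_mul_same V
  have h2 : Vᴴ * ((c : ℂ) • B - A) * V = (c : ℂ) • diagonal (fun i => (b i : ℂ)) -
      star (star U * V) * diagonal (fun i => (a i : ℂ)) * (star U * V) := by
    rw [← Matrix.star_eq_conjTranspose, Matrix.mul_sub, Matrix.sub_mul, hA, hB, star_mul, star_star]
    congr 1
    · rw [Matrix.mul_smul, Matrix.smul_mul]
      congr 1
      calc _ = (star V * V) * diagonal (fun i => (b i : ℂ)) * (star V * V) := by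
            simp only [Matrix.mul_assoc]
        _ = _ := by rw [hV]; simp
    · simp only [Matrix.mul_assoc]
  rw [h2] at h1
  have h3 := h1.diag_nonneg (i := j)
  have h4 : 0 ≤ -∑ i, wgt U V i j * a i := by
    have h5 := (Complex.le_def.1 h3).1
    rw [Matrix.sub_apply, Matrix.smul_apply, Matrix.diagonal_apply_eq, hj, Matrix.mul_apply] at h5
    simp only [Matrix.mul_diagonal, Matrix.star_apply] at h5
    simp only [Complex.zero_re, Complex.sub_re, Complex.re_sum] at h5
    convert h5 using 1
    simp only [Complex.ofReal_zero, smul_zero, Complex.zero_re, zero_sub]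
    congr 1
    refine Finset.sum_congr rfl fun i _ => ?_
    simp only [wgt, Complex.normSq_apply]
    simp
    ring
  have h6 : ∑ i, wgt U V i j * a i = 0 := le_antisymm (by linarith)
    (Finset.sum_nonneg fun i _ => mul_nonneg (wgt_nonneg _ _ _ _) (ha i))
  exact (Finset.sum_eq_zero_iff_of_nonneg
    (fun i _ => mul_nonneg (wgt_nonneg _ _ _ _) (ha i))).1 h6 i (Finset.mem_univ i)

theorem sc_low {a b : ℝ} (ha : 0 ≤ a) (hb : 0 < b) :
    0 ≤ a * Real.log a - a * Real.log b - a + b := by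
  rcases ha.eq_or_lt with h | h
  · subst h; simp; exact hb.le
  · have := Real.log_le_sub_one_of_pos (div_pos hb h)
    rw [Real.log_div hb.ne' h.ne'] at this
    have h2 := mul_le_mul_of_nonneg_left this ha
    have h3 : a * (b / a - 1) = b - a := by field_simp
    linarith [mul_sub a (Real.log b) (Real.log a)]

theorem sc_up {a b : ℝ} (ha : 0 ≤ a) (hb : 0 < b) :
    a * Real.log a - a * Real.log b - a + b ≤ b⁻¹ * (a - b) ^ 2 := by
  rcases ha.eq_or_lt with h | h
  · subst h; simp; field_simp; rfl
  · have := Real.log_le_sub_one_of_pos (div_pos h hb)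
    rw [Real.log_div h.ne' hb.ne'] at this
    have h2 := mul_le_mul_of_nonneg_left this ha
    have h3 : a * (a / b - 1) - a + b = b⁻¹ * (a - b) ^ 2 := by field_simp; ring
    linarith [mul_sub a (Real.log a) (Real.log b)]

theorem klein {d : ℕ} {A B : Matrix (Fin d) (Fin d) ℂ} (hA : A.PosSemidef)
    (hB : B.PosSemidef) (htr : A.trace = B.trace) (c : ℝ)
    (hc : ((c : ℂ) • B - A).PosSemidef) :
    0 ≤ qRelEnt A B := by
  obtain ⟨U, a, hU, hU', ha, eA, lA⟩ := specData hA
  obtain ⟨V, b, hV, hV', hb, eB, lB⟩ := specData hB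
  rw [(formulas hU hU' hV hV' eA lA eB lB htr).1]
  refine Finset.sum_nonneg fun i _ => Finset.sum_nonneg fun j _ => ?_
  rcases (hb j).eq_or_lt with h | h
  · have := ker_cond hV ha eA eB c hc i j h.symm
    rcases mul_eq_zero.1 this with h0 | h0
    · simp [h0]
    · simp [h0, ← h]
  · exact mul_nonneg (wgt_nonneg _ _ _ _) (sc_low (ha i) h)

theorem relEnt_up {d : ℕ} {B : Matrix (Fin d) (Fin d) ℂ} (hB : B.PosSemidef) :
    ∃ K : ℝ, ∀ A : Matrix (Fin d) (Fin d) ℂ, A.PosSemidef → A.trace = B.trace →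
      ∀ c : ℝ, ((c : ℂ) • B - A).PosSemidef →
      qRelEnt A B ≤ K * ((A - B) * (A - B)).trace.re := by
  obtain ⟨V, b, hV, hV', hb, eB, lB⟩ := specData hB
  refine ⟨∑ j, (b j)⁻¹, fun A hA htr c hc => ?_⟩
  obtain ⟨U, a, hU, hU', ha, eA, lA⟩ := specData hA
  rw [(formulas hU hU' hV hV' eA lA eB lB htr).1, (formulas hU hU' hV hV' eA lA eB lB htr).2]
  rw [Finset.mul_sum]
  refine Finset.sum_le_sum fun i _ => ?_
  rw [Finset.mul_sum]
  refine Finset.sum_le_sum fun j _ => ?_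
  have hK : (b j)⁻¹ ≤ ∑ j, (b j)⁻¹ :=
    Finset.single_le_sum (f := fun j => (b j)⁻¹) (fun j _ => inv_nonneg.2 (hb j)) (Finset.mem_univ j)
  rcases (hb j).eq_or_lt with h | h
  · have := ker_cond hV ha eA eB c hc i j h.symm
    rcases mul_eq_zero.1 this with h0 | h0
    · simp [h0]
    · simp [h0, ← h]
  · rw [mul_left_comm]
    refine mul_le_mul_of_nonneg_left ((sc_up (ha i) h).trans ?_) (wgt_nonneg _ _ _ _)
    exact mul_le_mul_of_nonneg_right hK (sq_nonneg _)

theorem le_const {d : ℕ} {R : Matrix (Fin d) (Fin d) ℂ} (hR : R.PosSemidef) :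
    ∃ c : ℝ, ((c : ℂ) • (1 : Matrix (Fin d) (Fin d) ℂ) - R).PosSemidef := by
  obtain ⟨U, a, hU, hU', ha, eA, lA⟩ := specData hR
  refine ⟨∑ i, a i, ?_⟩
  have : (((∑ i, a i : ℝ) : ℂ) • (1 : Matrix (Fin d) (Fin d) ℂ) - R) =
      U * diagonal (fun j => ((∑ i, a i - a j : ℝ) : ℂ)) * Uᴴ := by
    have h : diagonal (fun j => ((∑ i, a i - a j : ℝ) : ℂ)) =
      ((∑ i, a i : ℝ) : ℂ) • (1 : Matrix (Fin d) (Fin d) ℂ) - diagonal (fun j => (a j : ℂ)) := by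
      rw [← Matrix.diagonal_one, ← Matrix.diagonal_smul, Matrix.diagonal_sub]
      congr 1; ext j; simp
    rw [h, Matrix.mul_sub, Matrix.sub_mul, ← Matrix.star_eq_conjTranspose, ← eA]
    simp [hU']
  rw [this]
  refine Matrix.PosSemidef.mul_mul_conjTranspose_same (Matrix.PosSemidef.diagonal fun j => ?_) U
  have := Finset.single_le_sum (f := a) (fun j _ => ha j) (Finset.mem_univ j)
  have h2 : (0 : ℝ) ≤ ∑ i, a i - a j := by linarith
  exact Complex.zero_le_real.2 h2

theorem supp_dom {d : ℕ} {A B : Matrix (Fin d) (Fin d) ℂ} (hA : A.PosSemidef)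
    (hB : B.PosSemidef) (h : SuppLE A B) : ∃ c : ℝ, ((c : ℂ) • B - A).PosSemidef := by
  obtain ⟨V, b, hV, hV', hb, eB, lB⟩ := specData hB
  have hX : ∃ X, A = B * X := by
    have : ∀ j, ∃ x, B *ᵥ x = A.col j := by
      intro j
      have : A.mulVecLin (Pi.single j 1) ∈ LinearMap.range B.mulVecLin := h ⟨_, rfl⟩
      obtain ⟨x, hx⟩ := this
      exact ⟨x, by simpa using hx⟩
    choose x hx using this
    refine ⟨Matrix.of fun i j => x j i, ?_⟩
    ext i j
    exact (congrFun (hx j) i).symm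
  obtain ⟨X, hX⟩ := hX
  set R := star V * A * V with hRdef
  have hR : R.PosSemidef := hA.conjTranspose_mul_mul_same V
  have hrow : ∀ i j, b i = 0 → R i j = 0 := by
    intro i j hi
    have : R = diagonal (fun i => (b i : ℂ)) * (star V * X * V) := by
      rw [hRdef, hX, eB]
      calc _ = (star V * V) * (diagonal (fun i => (b i : ℂ)) * (star V * X * V)) := by
            simp only [Matrix.mul_assoc]
        _ = _ := by rw [hV, Matrix.one_mul]
    rw [this, Matrix.diagonal_mul, hi]; simp
  have hcol : ∀ i j, b j = 0 → R i j = 0 := by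
    intro i j hj
    rw [← hR.1.apply, hrow j i hj, star_zero]
  set D : Matrix (Fin d) (Fin d) ℂ := diagonal (fun i => (Real.sqrt (b i) : ℂ)) with hD
  set E : Matrix (Fin d) (Fin d) ℂ := diagonal (fun i => ((Real.sqrt (b i))⁻¹ : ℂ)) with hE
  have hDs : Dᴴ = D := by
    rw [hD, Matrix.diagonal_conjTranspose]; congr 1; ext i; simp
  have hEs : Eᴴ = E := by
    rw [hE, Matrix.diagonal_conjTranspose]; congr 1; ext i; simp
  have hDD : D * D = diagonal (fun i => (b i : ℂ)) := by
    rw [hD, Matrix.diagonal_mul_diagonal]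
    congr 1; ext i
    rw [← Complex.ofReal_mul, Real.mul_self_sqrt (hb i)]
  have hDE : D * (E * R * E) * D = R := by
    ext i j
    rw [hD, hE, Matrix.mul_diagonal, Matrix.diagonal_mul, Matrix.mul_diagonal, Matrix.diagonal_mul]
    by_cases hi : b i = 0
    · rw [hrow i j hi]; simp
    by_cases hj : b j = 0
    · rw [hcol i j hj]; simp
    have h1 : (Real.sqrt (b i) : ℂ) ≠ 0 := by
      exact_mod_cast (Real.sqrt_pos.2 (lt_of_le_of_ne (hb i) (Ne.symm hi))).ne'
    have h2 : (Real.sqrt (b j) : ℂ) ≠ 0 := by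
      exact_mod_cast (Real.sqrt_pos.2 (lt_of_le_of_ne (hb j) (Ne.symm hj))).ne'
    field_simp
  have hR' : (E * R * E).PosSemidef := by
    have := hR.conjTranspose_mul_mul_same E
    rwa [hEs] at this
  obtain ⟨c, hc⟩ := le_const hR'
  refine ⟨c, ?_⟩
  have h1 := (hc.conjTranspose_mul_mul_same D).mul_mul_conjTranspose_same V
  rw [hDs, Matrix.mul_sub, Matrix.sub_mul, hDE, Matrix.mul_smul, Matrix.mul_one,
    Matrix.smul_mul, hDD, Matrix.mul_sub, Matrix.sub_mul, Matrix.mul_smul, Matrix.smul_mul,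
    ← Matrix.star_eq_conjTranspose, ← eB] at h1
  have h2 : V * R * star V = A := by
    rw [hRdef]
    calc _ = (V * star V) * A * (V * star V) := by simp only [Matrix.mul_assoc]
      _ = A := by rw [hV']; simp
  rwa [h2] at h1

theorem small_t {L C : ℝ} (h : ∀ t : ℝ, 0 < t → t ≤ 1 → 0 ≤ t * L + C * t ^ 2) : 0 ≤ L := by
  have h2 : ∀ t : ℝ, 0 < t → t ≤ 1 → 0 ≤ L + C * t := fun t h0 h1 => by
    have := h t h0 h1
    have h3 : t * L + C * t ^ 2 = t * (L + C * t) := by ring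
    rw [h3] at this
    exact nonneg_of_mul_nonneg_right this h0
  by_contra hL
  push Not at hL
  have hC := h2 (min 1 (-L / (2 * (|C| + 1)))) (lt_min one_pos (by have := abs_nonneg C; apply div_pos <;> linarith)) (min_le_left _ _)
  have hp : 0 < |C| + 1 := by positivity
  set s := min 1 (-L / (2 * (|C| + 1))) with hs
  have hs0 : 0 < s := lt_min one_pos (by apply div_pos <;> linarith)
  have h5 : s ≤ -L / (2 * (|C| + 1)) := min_le_right _ _
  rw [le_div_iff₀ (by linarith)] at h5
  nlinarith [le_abs_self C, mul_le_mul_of_nonneg_right (le_abs_self C) hs0.le]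

/-- Mismatch-cost lower bound: if `φ` minimizes an EP-type function `Σ` over a convex set `𝒮`
of density matrices and `ρ ∈ 𝒮` has `supp ρ ⊆ supp φ`, then
`Σ(ρ) − Σ(φ) ≥ S(ρ‖φ) − S(Φ(ρ)‖Φ(φ))`. -/
theorem mismatch_cost_convex_lower_bound {d d' : ℕ} (hd : 1 ≤ d) (hd' : 1 ≤ d')
    (Φ : Matrix (Fin d) (Fin d) ℂ →ₗ[ℂ] Matrix (Fin d') (Fin d') ℂ) (hΦ : IsPTP Φ)
    (Q : Matrix (Fin d) (Fin d) ℂ →ₗ[ℝ] ℝ)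
    (𝒮 : Set (Matrix (Fin d) (Fin d) ℂ)) (h𝒮conv : Convex ℝ 𝒮)
    (h𝒮dens : ∀ ω ∈ 𝒮, IsDensity ω)
    (φ : Matrix (Fin d) (Fin d) ℂ) (hφ𝒮 : φ ∈ 𝒮)
    (hmin : ∀ ω ∈ 𝒮, EPfun Φ Q φ ≤ EPfun Φ Q ω)
    (ρ : Matrix (Fin d) (Fin d) ℂ) (hρ𝒮 : ρ ∈ 𝒮)
    (hsupp : SuppLE ρ φ) :
    qRelEnt ρ φ - qRelEnt (Φ ρ) (Φ φ) ≤ EPfun Φ Q ρ - EPfun Φ Q φ := by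
  obtain ⟨hφp, hφt⟩ := h𝒮dens φ hφ𝒮
  obtain ⟨hρp, hρt⟩ := h𝒮dens ρ hρ𝒮
  have key : ∀ X : Matrix (Fin d) (Fin d) ℂ,
      EPfun Φ Q X - EPfun Φ Q φ = (Q (X - φ) + ((X - φ) * matLog φ).trace.re
        - (Φ (X - φ) * matLog (Φ φ)).trace.re) + qRelEnt X φ - qRelEnt (Φ X) (Φ φ) := by
    intro X
    simp only [EPfun, vN, qRelEnt, map_sub, Matrix.mul_sub, Matrix.sub_mul, Matrix.trace_sub,
      Complex.sub_re]
    ring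
  rw [key ρ]
  obtain ⟨c, hc⟩ := supp_dom hρp hφp hsupp
  obtain ⟨K, hK⟩ := relEnt_up hφp
  suffices h : 0 ≤ Q (ρ - φ) + ((ρ - φ) * matLog φ).trace.re
        - (Φ (ρ - φ) * matLog (Φ φ)).trace.re by linarith
  refine small_t (C := K * ((ρ - φ) * (ρ - φ)).trace.re) fun t h0 h1 => ?_
  set ω := φ + t • (ρ - φ) with hω
  have hω𝒮 : ω ∈ 𝒮 := h𝒮conv.add_smul_sub_mem hφ𝒮 hρ𝒮 ⟨h0.le, h1⟩
  obtain ⟨hωp, hωt⟩ := h𝒮dens ω hω𝒮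
  have hωφ : ω - φ = (t : ℂ) • (ρ - φ) := by rw [hω, add_sub_cancel_left]; rfl
  have hωφ' : ω - φ = t • (ρ - φ) := by rw [hω, add_sub_cancel_left]
  have hdom : (((1 - t + t * c : ℝ) : ℂ) • φ - ω).PosSemidef := by
    have : ((1 - t + t * c : ℝ) : ℂ) • φ - ω = (t : ℂ) • ((c : ℂ) • φ - ρ) := by
      have : ω = φ + (t : ℂ) • (ρ - φ) := by rw [← hωφ]; abel
      rw [this]; push_cast; module
    rw [this]
    exact hc.smul (by exact_mod_cast h0.le)
  have hdom' : (((1 - t + t * c : ℝ) : ℂ) • Φ φ - Φ ω).PosSemidef := by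
    have := hΦ.1 _ hdom
    rwa [map_sub, map_smul] at this
  have hkl := klein (hΦ.1 _ hωp) (hΦ.1 _ hφp) (by rw [hΦ.2, hΦ.2, hωt, hφt]) _ hdom'
  have hup := hK ω hωp (by rw [hωt, hφt]) _ hdom
  have hk := key ω
  have hm := hmin ω hω𝒮
  have e1 : Q (ω - φ) = t * Q (ρ - φ) := by rw [hωφ', map_smul, smul_eq_mul]
  rw [e1, hωφ] at hk
  rw [hωφ] at hup
  simp only [map_smul, Matrix.smul_mul, Matrix.mul_smul, Matrix.trace_smul, smul_eq_mul,
    Complex.re_ofReal_mul] at hk hup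
  linarith [hk, hup, hm, hkl]
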